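/- Let p, q ≥ 1, let Q₁, …, Q_q be homogeneous quadratic polynomials on ℝᵖ, set A(ξ,η) = (1/2)|ξ|² − |η|² and B(ξ,η) = Σ_{i=1}^{q} η_i Q_i(ξ) on ℝᵖ × ℝ^q. Then the identity A(ξ,η)² + |∇B(ξ,η)|² = (|ξ|² + |η|²)² holds for all (ξ,η) if and only if both: (i) Σ_{i=1}^{q} Q_i(ξ)² = (3/4)|ξ|⁴ for all ξ, and (ii) ⟨∇Q_i(ξ), ∇Q_j(ξ)⟩ = 3δ_{ij}|ξ|² for all ξ and all i, j, where δ_{ij} is the Kronecker delta. -/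

import Mathlib

open MvPolynomial

/-- A family of vectors is orthogonal with common squared length `c` iff forming linear
combinations scales squared lengths by `c`. -/
theorem sum_sq_combination_eq_iff {ι κ : Type*} [Fintype ι] [Fintype κ] [DecidableEq ι]
    (v : ι → κ → ℝ) (c : ℝ) :
    (∀ η : ι → ℝ, ∑ k, (∑ l, η l * v l k) ^ 2 = c * ∑ l, η l ^ 2) ↔
      ∀ i j, ∑ k, v i k * v j k = if i = j then c else 0 := by
  constructor
  · intro h
    have diag (i : ι) : ∑ k, v i k * v i k = c := by
      simpa [Pi.single_apply, ← pow_two] using h (Pi.single i 1)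
    intro i j
    split_ifs with hij
    · subst hij
      exact diag i
    · have hadd := h (Pi.single i 1 + Pi.single j 1)
      simp only [Pi.add_apply, add_mul, Finset.sum_add_distrib, add_sq, Pi.single_apply, ite_mul,
        one_mul, zero_mul, Finset.sum_ite_eq', Finset.mem_univ, if_true, ite_pow, one_pow,
        mul_ite, mul_one, mul_zero, ne_eq, OfNat.ofNat_ne_zero, not_false_eq_true, zero_pow,
        Ne.symm hij, if_false, mul_assoc, ← Finset.mul_sum] at hadd
      have hi := diag i
      have hj := diag j
      simp only [← pow_two] at hi hj
      linarith
  · intro h η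
    calc ∑ k, (∑ l, η l * v l k) ^ 2
        = ∑ i, ∑ j, η i * η j * ∑ k, v i k * v j k := by
          simp only [pow_two, Finset.sum_mul_sum]
          simp only [Finset.mul_sum]
          rw [Finset.sum_comm]
          refine Finset.sum_congr rfl fun i _ => ?_
          rw [Finset.sum_comm]
          exact Finset.sum_congr rfl fun j _ => Finset.sum_congr rfl fun k _ => by ring
      _ = c * ∑ l, η l ^ 2 := by
          simp only [h, mul_ite, mul_zero, Finset.sum_ite_eq, Finset.mem_univ, if_true,
            Finset.mul_sum]
          exact Finset.sum_congr rfl fun i _ => by ring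

section PairingGradient

variable {σ τ R : Type*} [CommSemiring R] [Fintype τ] (Q : τ → MvPolynomial σ R)
  (x : σ ⊕ τ → R)

theorem eval_pderiv_inl_sum_X_inr_mul_rename (k : σ) :
    eval x (pderiv (Sum.inl k) (∑ l, X (Sum.inr l) * rename Sum.inl (Q l))) =
      ∑ l, x (Sum.inr l) * eval (x ∘ Sum.inl) (pderiv k (Q l)) := by
  classical
  simp [pderiv_rename Sum.inl_injective, pderiv_X, eval_rename]

theorem eval_pderiv_inr_sum_X_inr_mul_rename (j : τ) :
    eval x (pderiv (Sum.inr j) (∑ l, X (Sum.inr l) * rename Sum.inl (Q l))) =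
      eval (x ∘ Sum.inl) (Q j) := by
  classical
  have hzero (l : τ) : pderiv (Sum.inr j) (rename (Sum.inl : σ → σ ⊕ τ) (Q l)) = 0 := by
    refine pderiv_eq_zero_of_notMem_vars fun hmem => ?_
    simpa using vars_rename Sum.inl (Q l) hmem
  simp [hzero, pderiv_X, Pi.single_apply, eval_rename, apply_ite]

end PairingGradient

/-- For `A(ξ,η) = (1/2)|ξ|² − |η|²` and `B(ξ,η) = Σᵢ ηᵢ Qᵢ(ξ)` with quadratic forms
`Qᵢ`, the identity `A² + |∇B|² = (|ξ|² + |η|²)²` holds iff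
(i) `Σᵢ Qᵢ(ξ)² = (3/4)|ξ|⁴` and (ii) `⟨∇Qᵢ, ∇Qⱼ⟩ = 3δᵢⱼ|ξ|²`. -/
theorem third_identity_iff_quadratic_system (p q : ℕ) (hp : 1 ≤ p) (hq : 1 ≤ q)
    (Q : Fin q → MvPolynomial (Fin p) ℝ) (hQ : ∀ i, (Q i).IsHomogeneous 2) :
    (∀ x : (Fin p ⊕ Fin q) → ℝ,
        (1 / 2 * ∑ k : Fin p, x (Sum.inl k) ^ 2 - ∑ j : Fin q, x (Sum.inr j) ^ 2) ^ 2 +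
          ∑ i : Fin p ⊕ Fin q,
            (eval x (pderiv i
              (∑ l : Fin q, X (Sum.inr l) * rename Sum.inl (Q l)))) ^ 2 =
          (∑ k : Fin p, x (Sum.inl k) ^ 2 + ∑ j : Fin q, x (Sum.inr j) ^ 2) ^ 2) ↔
      ((∀ ξ : Fin p → ℝ,
          ∑ i, (eval ξ (Q i)) ^ 2 = 3 / 4 * (∑ k, ξ k ^ 2) ^ 2) ∧
        (∀ (ξ : Fin p → ℝ) (i j : Fin q),
          ∑ k, eval ξ (pderiv k (Q i)) * eval ξ (pderiv k (Q j)) =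
            (if i = j then 3 else 0) * ∑ k, ξ k ^ 2)) := by
  simp only [Fintype.sum_sum_type, eval_pderiv_inl_sum_X_inr_mul_rename,
    eval_pderiv_inr_sum_X_inr_mul_rename]
  have orthogonality_iff (ξ : Fin p → ℝ) :=
    sum_sq_combination_eq_iff (fun l k => eval ξ (pderiv k (Q l))) (3 * ∑ k, ξ k ^ 2)
  constructor
  · intro h
    have h' (ξ : Fin p → ℝ) (η : Fin q → ℝ) := h (Sum.elim ξ η)
    simp only [Sum.elim_inl, Sum.elim_inr, Sum.elim_comp_inl] at h'
    have hnorm (ξ : Fin p → ℝ) : ∑ i, (eval ξ (Q i)) ^ 2 = 3 / 4 * (∑ k, ξ k ^ 2) ^ 2 := by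
      have h0 := h' ξ 0
      simp only [Pi.zero_apply, zero_mul, Finset.sum_const_zero, ne_eq, OfNat.ofNat_ne_zero,
        not_false_eq_true, zero_pow] at h0
      linarith
    refine ⟨hnorm, fun ξ i j => ?_⟩
    rw [ite_mul, zero_mul]
    refine (orthogonality_iff ξ).1 (fun η => ?_) i j
    linarith [h' ξ η, hnorm ξ]
  · rintro ⟨hnorm, horth⟩ x
    have hgrad := (orthogonality_iff (x ∘ Sum.inl)).2
      (fun i j => by rw [horth, ite_mul, zero_mul]) (x ∘ Sum.inr)
    have hS := hnorm (x ∘ Sum.inl)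
    simp only [Function.comp_apply] at hgrad hS
    rw [hgrad, hS]
    ring
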